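/- Let Q ∈ H_𝔽 and suppose assumptions (A1)–(A6) hold. Given an initial condition x_0 ∈ ℝᴺ, the minimizer of I_N over the set of controls v ∈ H_𝔽ᴺ satisfying the balance condition (1/N) Σ_{i=1}^N vⁱ = Q is unique: if v* and ṽ both minimize I_N over this set, then v*ⁱ = ṽⁱ (dt⊗dP)-a.e. for every i = 1,…,N. -/

import Mathlib

/- STATEMENT 8: Uniqueness of the minimizer of the constrained N-agent problem
   under (A1)-(A6): two balanced minimizers of I_N have (dt⊗dP)-a.e. equal
   components. -/

open MeasureTheory

noncomputable section

/-- Membership in the space `H_𝔽`: progressively measurable processes with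
`E[∫_0^T v_t² dt] < ∞`. -/
def MemH {Ω : Type*} {m : MeasurableSpace Ω} (P : Measure Ω) (T : ℝ)
    (𝔽 : Filtration ℝ m) (v : ℝ → Ω → ℝ) : Prop :=
  ProgMeasurable 𝔽 v ∧
    (∫⁻ ω, (∫⁻ t in Set.Ioc (0:ℝ) T, ENNReal.ofReal ((v t ω) ^ 2)) ∂P) < ⊤

/-- Trajectory `X_t = x₀ + ∫_0^t v_s ds`. -/
def traj {Ω : Type*} (x0 : ℝ) (v : ℝ → Ω → ℝ) (t : ℝ) (ω : Ω) : ℝ :=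
  x0 + ∫ s in (0:ℝ)..t, v s ω

/-- The product measure dt ⊗ dP on (0,T] × Ω. -/
def timeProd {Ω : Type*} {_m : MeasurableSpace Ω} (P : Measure Ω) (T : ℝ) :
    Measure (ℝ × Ω) :=
  (volume.restrict (Set.Ioc (0:ℝ) T)).prod P

/-- Balance condition: (1/N) Σᵢ vⁱ = Q in H_𝔽, i.e. (dt⊗dP)-a.e. -/
def Balance {Ω : Type*} {_m : MeasurableSpace Ω} (P : Measure Ω) (T : ℝ)
    (N : ℕ) (v : Fin N → ℝ → Ω → ℝ) (Q : ℝ → Ω → ℝ) : Prop :=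
  (fun p : ℝ × Ω => (1 / (N:ℝ)) * ∑ i, v i p.1 p.2) =ᵐ[timeProd P T]
    (fun p => Q p.1 p.2)

/-- The N-agent functional I_N. -/
def costN {Ω : Type*} {_m : MeasurableSpace Ω} (P : Measure Ω) (T : ℝ)
    (L : ℝ → ℝ → ℝ) (Ψ : ℝ → ℝ) (N : ℕ) (x0 : Fin N → ℝ)
    (v : Fin N → ℝ → Ω → ℝ) : ℝ :=
  (1 / (N:ℝ)) * ∑ i, ∫ ω, ((∫ t in Set.Ioc (0:ℝ) T,
      L (traj (x0 i) (v i) t ω) (v i t ω)) + Ψ (traj (x0 i) (v i) T ω)) ∂P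

lemma aux_const {f : ℝ → ℝ} (hf : ConvexOn ℝ Set.univ f) {M : ℝ} (hM : ∀ x, f x ≤ M) (x y : ℝ) :
    f y ≤ f x := by
  by_contra hlt
  push Not at hlt
  obtain ⟨n, hn⟩ := exists_nat_gt ((M - f x) / (f y - f x))
  have hd : 0 < f y - f x := by linarith
  rw [div_lt_iff₀ hd] at hn
  have hMx := hM y
  have hnpos : (0:ℝ) < n := by
    by_contra h0
    push Not at h0
    nlinarith
  have hn1 : (1:ℝ) ≤ n := by
    have : 0 < n := by exact_mod_cast hnpos
    exact_mod_cast this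
  have hi : (n:ℝ)⁻¹ ≤ 1 := inv_le_one_of_one_le₀ hn1
  have hi0 : 0 < (n:ℝ)⁻¹ := inv_pos.mpr hnpos
  have hm : (n:ℝ) * (n:ℝ)⁻¹ = 1 := mul_inv_cancel₀ hnpos.ne'
  have h := hf.2 (Set.mem_univ x) (Set.mem_univ (x + n * (y - x)))
    (by linarith : (0:ℝ) ≤ 1 - (n:ℝ)⁻¹) hi0.le (by ring)
  simp only [smul_eq_mul] at h
  have e : (1 - (n:ℝ)⁻¹) * x + (n:ℝ)⁻¹ * (x + n * (y - x)) = y := by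
    linear_combination (y - x) * hm
  rw [e] at h
  have h2 := hM (x + n * (y - x))
  have h3 : (n:ℝ)⁻¹ * f (x + n * (y - x)) ≤ (n:ℝ)⁻¹ * M := by gcongr
  have h4 : f y - f x ≤ (n:ℝ)⁻¹ * (M - f x) := by linarith
  have h5 : (n:ℝ)⁻¹ * (M - f x) < (n:ℝ)⁻¹ * (n * (f y - f x)) := by gcongr
  have h6 : (n:ℝ)⁻¹ * (n * (f y - f x)) = f y - f x := by
    linear_combination (f y - f x) * hm
  linarith

section aux
variable {Ω : Type*} {m : MeasurableSpace Ω} {P : Measure Ω} {T : ℝ} {𝔽 : Filtration ℝ m}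

lemma aux_meas {v : ℝ → Ω → ℝ} (h : MemH P T 𝔽 v) :
    Measurable (fun p : ℝ × Ω => v p.1 p.2) := by
  refine measurable_of_tendsto_metrizable
    (f := fun (n : ℕ) (p : ℝ × Ω) => v (min p.1 n) p.2) ?_ ?_
  · intro n
    have h1 := (h.1 (n:ℝ)).measurable
    have hg : @Measurable _ _ _ (@Prod.instMeasurableSpace _ _ _ (𝔽 (n:ℝ)))
        (fun p : ℝ × Ω => ((⟨min p.1 n, Set.mem_Iic.2 (min_le_right _ _)⟩ : Set.Iic (n:ℝ)), p.2)) := by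
      refine @Measurable.prodMk _ _ _ _ _ (𝔽 (n:ℝ)) _ _ ?_ ?_
      · exact (measurable_fst.min measurable_const).subtype_mk
      · exact measurable_snd.mono le_rfl (𝔽.le _)
    exact h1.comp hg
  · rw [tendsto_pi_nhds]
    intro p
    refine tendsto_const_nhds.congr' ?_
    obtain ⟨k, hk⟩ := exists_nat_ge p.1
    filter_upwards [Filter.eventually_ge_atTop k] with n hn
    rw [min_eq_left]
    exact hk.trans (by exact_mod_cast hn)

variable [IsProbabilityMeasure P]

lemma aux_sq {v : ℝ → Ω → ℝ} (h : MemH P T 𝔽 v) :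
    Integrable (fun p : ℝ × Ω => (v p.1 p.2) ^ 2) (timeProd P T) := by
  have hm := (aux_meas h).pow_const 2
  refine ⟨hm.aestronglyMeasurable, ?_⟩
  rw [hasFiniteIntegral_iff_ofReal (Filter.Eventually.of_forall fun p => sq_nonneg _)]
  unfold timeProd
  rw [lintegral_prod_symm' _ hm.ennreal_ofReal]
  exact h.2

instance aux_fin : IsFiniteMeasure (timeProd P T) := by
  unfold timeProd; infer_instance

lemma aux_comp {v : ℝ → Ω → ℝ} (h : MemH P T 𝔽 v) {f : ℝ → ℝ} (hf : Continuous f) {C : ℝ}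
    (hC : ∀ x, |f x| ≤ C * (1 + |x| ^ 2)) :
    Integrable (fun p : ℝ × Ω => f (v p.1 p.2)) (timeProd P T) := by
  refine Integrable.mono' (((integrable_const (1:ℝ)).add (aux_sq h)).const_mul C)
    (hf.measurable.comp (aux_meas h)).aestronglyMeasurable
    (Filter.Eventually.of_forall fun p => ?_)
  have := hC (v p.1 p.2)
  simpa [sq_abs] using this

lemma aux_id {v : ℝ → Ω → ℝ} (h : MemH P T 𝔽 v) :
    Integrable (fun p : ℝ × Ω => v p.1 p.2) (timeProd P T) :=
  aux_comp h (f := fun x => x) continuous_id (C := 1) (fun x => by nlinarith [sq_nonneg (|x| - 1)])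

lemma aux_cs {μ : Measure ℝ} [IsFiniteMeasure μ] {f : ℝ → ℝ} (hf : Integrable f μ)
    (hf2 : Integrable (fun t => f t ^ 2) μ) :
    (∫ t, f t ∂μ) ^ 2 ≤ μ.real Set.univ * ∫ t, f t ^ 2 ∂μ := by
  set A := ∫ t, f t ∂μ
  set c := μ.real Set.univ
  have hc : 0 ≤ c := measureReal_nonneg
  have h : 0 ≤ ∫ t, (c * f t - A) ^ 2 ∂μ := integral_nonneg fun t => sq_nonneg _
  have e : ∫ t, (c * f t - A) ^ 2 ∂μ = c ^ 2 * (∫ t, f t ^ 2 ∂μ) - 2 * c * A * A + A ^ 2 * c := by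
    have : (fun t => (c * f t - A) ^ 2) = fun t => (c ^ 2 * f t ^ 2 - 2 * c * A * f t) + A ^ 2 := by
      funext t; ring
    rw [this, integral_add, integral_sub, integral_const_mul, integral_const_mul, integral_const]
    · simp only [smul_eq_mul]; ring
    · exact hf2.const_mul _
    · exact hf.const_mul _
    · exact (hf2.const_mul _).sub (hf.const_mul _)
    · exact integrable_const _
  rcases hc.eq_or_lt with h0 | h0
  · have : μ = 0 := by
      rw [← Measure.measure_univ_eq_zero]
      simpa [c, Measure.real, ENNReal.toReal_eq_zero_iff] using h0.symm
    simp [A, this]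
  · rw [e] at h
    have : 0 ≤ c * (c * (∫ t, f t ^ 2 ∂μ) - A ^ 2) := by linarith
    have := nonneg_of_mul_nonneg_right this h0
    linarith

lemma aux_traj (hT : 0 < T) (x : ℝ) (v : ℝ → Ω → ℝ) (ω : Ω) :
    traj x v T ω = x + ∫ s in Set.Ioc 0 T, v s ω := by
  rw [traj, intervalIntegral.integral_of_le hT.le]

lemma aux_psi (hT : 0 < T) {v : ℝ → Ω → ℝ} (h : MemH P T 𝔽 v) (x : ℝ) {Ψ : ℝ → ℝ}
    (hΨ : Continuous Ψ) {C : ℝ} (hC0 : 0 < C) (hC : ∀ x, |Ψ x| ≤ C * (1 + |x| ^ 2)) :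
    Integrable (fun ω => Ψ (traj x v T ω)) P := by
  have h1 := aux_id h
  have h2 := aux_sq h
  unfold timeProd at h1 h2
  have hm : AEStronglyMeasurable (fun ω => traj x v T ω) P := by
    simp_rw [aux_traj hT]
    exact aestronglyMeasurable_const.add h1.integral_prod_right.aestronglyMeasurable
  refine Integrable.mono' (g := fun ω => C * (1 + 2 * x ^ 2 + 2 *
      ((volume.restrict (Set.Ioc 0 T)).real Set.univ * ∫ s in Set.Ioc 0 T, v s ω ^ 2))) ?_
    (hΨ.comp_aestronglyMeasurable hm) ?_
  · exact ((integrable_const _).add ((h2.integral_prod_right.const_mul _).const_mul _)).const_mul _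
  · filter_upwards [h1.prod_left_ae, h2.prod_left_ae] with ω a1 a2
    have := aux_cs a1 a2
    refine (hC _).trans ?_
    rw [aux_traj hT, sq_abs]
    refine mul_le_mul_of_nonneg_left ?_ hC0.le
    nlinarith [sq_nonneg (x - ∫ s in Set.Ioc 0 T, v s ω)]

lemma aux_mid {v w : ℝ → Ω → ℝ} (hv : MemH P T 𝔽 v) (hw : MemH P T 𝔽 w) :
    MemH P T 𝔽 (fun t ω => 2⁻¹ * (v t ω + w t ω)) := by
  refine ⟨fun i => ((hv.1 i).add (hw.1 i)).const_mul _, ?_⟩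
  have mv := ((aux_meas hv).pow_const 2).ennreal_ofReal
  have mw := ((aux_meas hw).pow_const 2).ennreal_ofReal
  calc _ ≤ ∫⁻ ω, ((∫⁻ t in Set.Ioc (0:ℝ) T, ENNReal.ofReal ((v t ω) ^ 2)) +
        (∫⁻ t in Set.Ioc (0:ℝ) T, ENNReal.ofReal ((w t ω) ^ 2))) ∂P := by
        refine lintegral_mono fun ω => ?_
        rw [← lintegral_add_left (show Measurable (fun t => ENNReal.ofReal (v t ω ^ 2)) from
          mv.comp measurable_prodMk_right)]
        refine lintegral_mono fun t => ?_
        rw [← ENNReal.ofReal_add (sq_nonneg _) (sq_nonneg _)]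
        refine ENNReal.ofReal_le_ofReal ?_
        nlinarith [sq_nonneg (v t ω - w t ω), sq_nonneg (v t ω + w t ω)]
    _ = _ := lintegral_add_left (mv.lintegral_prod_left') _
    _ < ⊤ := ENNReal.add_lt_top.mpr ⟨hv.2, hw.2⟩

lemma aux_sqdiff {v w : ℝ → Ω → ℝ} (hv : MemH P T 𝔽 v) (hw : MemH P T 𝔽 w) :
    Integrable (fun p : ℝ × Ω => (v p.1 p.2 - w p.1 p.2) ^ 2) (timeProd P T) := by
  refine Integrable.mono' (((aux_sq hv).add (aux_sq hw)).const_mul 2)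
    (((aux_meas hv).sub (aux_meas hw)).pow_const 2).aestronglyMeasurable
    (Filter.Eventually.of_forall fun p => ?_)
  rw [Real.norm_of_nonneg (sq_nonneg _)]
  simp only [Pi.add_apply]
  nlinarith [sq_nonneg (v p.1 p.2 + w p.1 p.2)]

lemma aux_key (hT : 0 < T) {v w : ℝ → Ω → ℝ} (hv : MemH P T 𝔽 v) (hw : MemH P T 𝔽 w) (x : ℝ)
    {Ψ l : ℝ → ℝ} (hΨ : Continuous Ψ) {C : ℝ} (hC0 : 0 < C) (hC : ∀ x, |Ψ x| ≤ C * (1 + |x| ^ 2))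
    (hΨc : ConvexOn ℝ Set.univ Ψ)
    (hl : Continuous l) {B : ℝ} (hB : ∀ x, |l x| ≤ B * (1 + |x| ^ 2)) {θ : ℝ}
    (hlc : ∀ a b, l (2⁻¹ * (a + b)) ≤ 2⁻¹ * (l a + l b) - θ / 8 * (a - b) ^ 2) :
    ∫ ω, ((∫ t in Set.Ioc (0:ℝ) T, l (2⁻¹ * (v t ω + w t ω))) +
        Ψ (traj x (fun t ω => 2⁻¹ * (v t ω + w t ω)) T ω)) ∂P ≤
      2⁻¹ * (∫ ω, ((∫ t in Set.Ioc (0:ℝ) T, l (v t ω)) + Ψ (traj x v T ω)) ∂P +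
        ∫ ω, ((∫ t in Set.Ioc (0:ℝ) T, l (w t ω)) + Ψ (traj x w T ω)) ∂P)
      - θ / 8 * ∫ p, (v p.1 p.2 - w p.1 p.2) ^ 2 ∂(timeProd P T) := by
  have hu := aux_mid hv hw
  have lv := aux_comp hv hl hB
  have lw := aux_comp hw hl hB
  have lu := aux_comp hu hl hB
  have iv := aux_id hv
  have iw := aux_id hw
  have sd := aux_sqdiff hv hw
  have pv := aux_psi hT hv x hΨ hC0 hC
  have pw := aux_psi hT hw x hΨ hC0 hC
  have pu := aux_psi hT hu x hΨ hC0 hC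
  unfold timeProd at *
  rw [integral_prod_symm _ sd]
  have Fv : Integrable (fun ω => ((∫ t in Set.Ioc (0:ℝ) T, l (v t ω)) + Ψ (traj x v T ω))) P :=
    lv.integral_prod_right.add pv
  have Fw : Integrable (fun ω => ((∫ t in Set.Ioc (0:ℝ) T, l (w t ω)) + Ψ (traj x w T ω))) P :=
    lw.integral_prod_right.add pw
  have Fu := lu.integral_prod_right.add pu
  have Fd : Integrable (fun ω => ∫ t in Set.Ioc (0:ℝ) T, (v t ω - w t ω) ^ 2) P :=
    sd.integral_prod_right
  have Fs : Integrable (fun ω => 2⁻¹ * (((∫ t in Set.Ioc (0:ℝ) T, l (v t ω)) + Ψ (traj x v T ω)) +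
      ((∫ t in Set.Ioc (0:ℝ) T, l (w t ω)) + Ψ (traj x w T ω)))) P := (Fv.add Fw).const_mul _
  have e : 2⁻¹ * (∫ ω, ((∫ t in Set.Ioc (0:ℝ) T, l (v t ω)) + Ψ (traj x v T ω)) ∂P +
        ∫ ω, ((∫ t in Set.Ioc (0:ℝ) T, l (w t ω)) + Ψ (traj x w T ω)) ∂P)
      - θ / 8 * ∫ ω, (∫ t in Set.Ioc (0:ℝ) T, (v t ω - w t ω) ^ 2) ∂P =
      ∫ ω, (2⁻¹ * (((∫ t in Set.Ioc (0:ℝ) T, l (v t ω)) + Ψ (traj x v T ω)) +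
        ((∫ t in Set.Ioc (0:ℝ) T, l (w t ω)) + Ψ (traj x w T ω))) -
        θ / 8 * ∫ t in Set.Ioc (0:ℝ) T, (v t ω - w t ω) ^ 2) ∂P := by
    rw [integral_sub Fs (Fd.const_mul _), integral_const_mul,
      integral_const_mul]
    congr 2
    exact (integral_add Fv Fw).symm
  rw [e]
  refine integral_mono_ae Fu (Fs.sub (Fd.const_mul _)) ?_
  filter_upwards [lv.prod_left_ae, lw.prod_left_ae, lu.prod_left_ae, iv.prod_left_ae,
    iw.prod_left_ae, sd.prod_left_ae] with ω av aw au bv bw ad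
  have h1 : (∫ t in Set.Ioc (0:ℝ) T, l (2⁻¹ * (v t ω + w t ω))) ≤
      2⁻¹ * ((∫ t in Set.Ioc (0:ℝ) T, l (v t ω)) + ∫ t in Set.Ioc (0:ℝ) T, l (w t ω)) -
        θ / 8 * ∫ t in Set.Ioc (0:ℝ) T, (v t ω - w t ω) ^ 2 := by
    have as : Integrable (fun t => 2⁻¹ * (l (v t ω) + l (w t ω)))
        (volume.restrict (Set.Ioc (0:ℝ) T)) := (av.add aw).const_mul _
    rw [← integral_add av aw, ← integral_const_mul, ← integral_const_mul,
      ← integral_sub as (ad.const_mul _)]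
    exact integral_mono au (as.sub (ad.const_mul _)) fun t => hlc _ _
  have h2 : Ψ (traj x (fun t ω => 2⁻¹ * (v t ω + w t ω)) T ω) ≤
      2⁻¹ * (Ψ (traj x v T ω) + Ψ (traj x w T ω)) := by
    have e2 : traj x (fun t ω => 2⁻¹ * (v t ω + w t ω)) T ω =
        2⁻¹ * traj x v T ω + 2⁻¹ * traj x w T ω := by
      simp only [aux_traj hT]
      rw [integral_const_mul, integral_add bv bw]
      ring
    have := hΨc.2 (Set.mem_univ (traj x v T ω)) (Set.mem_univ (traj x w T ω))
      (by norm_num : (0:ℝ) ≤ 2⁻¹) (by norm_num : (0:ℝ) ≤ 2⁻¹) (by norm_num)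
    simp only [smul_eq_mul] at this
    rw [e2]
    linarith
  linarith

end aux

theorem optimal_control_N_agent_unique
    {Ω : Type*} {m : MeasurableSpace Ω} (P : Measure Ω) [IsProbabilityMeasure P]
    (T : ℝ) (hT : 0 < T) (𝔽 : Filtration ℝ m)
    (L : ℝ → ℝ → ℝ) (Ψ : ℝ → ℝ)
    -- (A1): L ∈ C¹, nonnegative, jointly convex
    (hL_C1 : ContDiff ℝ 1 (Function.uncurry L))
    (hL_nonneg : ∀ x v, 0 ≤ L x v)
    (hL_convex : ConvexOn ℝ Set.univ (Function.uncurry L))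
    -- (A2): Ψ ∈ C¹, nonnegative, convex
    (hΨ_C1 : ContDiff ℝ 1 Ψ)
    (hΨ_nonneg : ∀ x, 0 ≤ Ψ x)
    (hΨ_convex : ConvexOn ℝ Set.univ Ψ)
    -- (A3): growth of Ψ and Ψ'
    (hΨ_growth : ∃ C > (0:ℝ), ∀ x, Ψ x ≤ C * (1 + |x| ^ 2))
    (hΨ'_growth : ∃ C > (0:ℝ), ∀ x, |deriv Ψ x| ≤ C * (1 + |x|))
    -- (A4): growth of L, L_x, L_v
    (hL_growth : ∃ β > (0:ℝ), ∀ x v, L x v ≤ β * (1 + |v| ^ 2))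
    (hL_deriv_growth : ∃ C > (0:ℝ), ∀ x v,
      |deriv (fun y => L y v) x| ≤ C * (1 + |v|) ∧
      |deriv (fun w => L x w) v| ≤ C * (1 + |v|))
    -- (A5): coercivity of L
    (α β : ℝ) (hα : 0 < α) (hβ : 0 ≤ β)
    (hL_coercive : ∀ x v, α * |v| ^ 2 - β ≤ L x v)
    -- (A6): uniform convexity of L in v
    (hL_unif_convex : ∃ θ > (0:ℝ), ∀ x,
      ConvexOn ℝ Set.univ (fun v => L x v - θ / 2 * v ^ 2))
    (N : ℕ) (hN : 0 < N) (x0 : Fin N → ℝ)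
    (Q : ℝ → Ω → ℝ) (hQ : MemH P T 𝔽 Q)
    (vstar vtil : Fin N → ℝ → Ω → ℝ)
    (hvstar : ∀ i, MemH P T 𝔽 (vstar i)) (hvtil : ∀ i, MemH P T 𝔽 (vtil i))
    (hbal_star : Balance P T N vstar Q) (hbal_til : Balance P T N vtil Q)
    (hmin_star : ∀ v : Fin N → ℝ → Ω → ℝ, (∀ i, MemH P T 𝔽 (v i)) →
      Balance P T N v Q → costN P T L Ψ N x0 vstar ≤ costN P T L Ψ N x0 v)
    (hmin_til : ∀ v : Fin N → ℝ → Ω → ℝ, (∀ i, MemH P T 𝔽 (v i)) →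
      Balance P T N v Q → costN P T L Ψ N x0 vtil ≤ costN P T L Ψ N x0 v) :
    ∀ i, (fun p : ℝ × Ω => vstar i p.1 p.2) =ᵐ[timeProd P T]
      (fun p => vtil i p.1 p.2) := by
  obtain ⟨C, hC0, hC⟩ := hΨ_growth
  obtain ⟨B, hB0, hB⟩ := hL_growth
  obtain ⟨θ, hθ, hθc⟩ := hL_unif_convex
  have hconst : ∀ x v, L x v = L 0 v := by
    intro x v
    have hc : ConvexOn ℝ Set.univ (fun y => L y v) := by
      refine ⟨convex_univ, fun a _ b _ s t hs ht hst => ?_⟩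
      have := hL_convex.2 (Set.mem_univ (a, v)) (Set.mem_univ (b, v)) hs ht hst
      simpa [Function.uncurry, ← add_mul, hst] using this
    exact le_antisymm (aux_const hc (fun y => hB y v) 0 x) (aux_const hc (fun y => hB y v) x 0)
  have hlcont : Continuous (fun v => L 0 v) :=
    hL_C1.continuous.comp (by fun_prop : Continuous fun v : ℝ => ((0:ℝ), v))
  have hlB : ∀ v, |L 0 v| ≤ B * (1 + |v| ^ 2) := fun v => by
    rw [abs_of_nonneg (hL_nonneg _ _)]; exact hB 0 v
  have hΨB : ∀ v, |Ψ v| ≤ C * (1 + |v| ^ 2) := fun v => by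
    rw [abs_of_nonneg (hΨ_nonneg _)]; exact hC v
  have hlc : ∀ a b, L 0 (2⁻¹ * (a + b)) ≤ 2⁻¹ * (L 0 a + L 0 b) - θ / 8 * (a - b) ^ 2 := by
    intro a b
    have := (hθc 0).2 (Set.mem_univ a) (Set.mem_univ b)
      (by norm_num : (0:ℝ) ≤ 2⁻¹) (by norm_num : (0:ℝ) ≤ 2⁻¹) (by norm_num)
    simp only [smul_eq_mul] at this
    rw [← mul_add] at this
    nlinarith
  have key := fun i => aux_key hT (hvstar i) (hvtil i) (x0 i) hΨ_C1.continuous hC0 hΨB hΨ_convex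
    hlcont hlB hlc
  have hbal : Balance P T N (fun i t ω => 2⁻¹ * (vstar i t ω + vtil i t ω)) Q := by
    unfold Balance at *
    filter_upwards [hbal_star, hbal_til] with p h1 h2
    rw [← Finset.mul_sum, Finset.sum_add_distrib]
    linarith
  have m1 := hmin_star _ (fun i => aux_mid (hvstar i) (hvtil i)) hbal
  have m2 := hmin_til _ (fun i => aux_mid (hvstar i) (hvtil i)) hbal
  have hNr : (0:ℝ) < 1 / N := by positivity
  unfold costN at m1 m2
  have m1 := le_of_mul_le_mul_left m1 hNr
  have m2 := le_of_mul_le_mul_left m2 hNr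
  simp only [hconst (traj _ _ _ _)] at m1 m2
  have ks := Finset.sum_le_sum fun i (_ : i ∈ Finset.univ) => key i
  rw [Finset.sum_sub_distrib, ← Finset.mul_sum, ← Finset.mul_sum, Finset.sum_add_distrib] at ks
  have hz : θ / 8 * ∑ i, ∫ p, (vstar i p.1 p.2 - vtil i p.1 p.2) ^ 2 ∂(timeProd P T) ≤ 0 := by
    linarith
  have hz' : ∑ i, ∫ p, (vstar i p.1 p.2 - vtil i p.1 p.2) ^ 2 ∂(timeProd P T) ≤ 0 :=
    nonpos_of_mul_nonpos_right hz (by positivity)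
  have hnn : ∀ i ∈ Finset.univ,
      0 ≤ ∫ p, (vstar i p.1 p.2 - vtil i p.1 p.2) ^ 2 ∂(timeProd P T) :=
    fun i _ => integral_nonneg fun p => sq_nonneg _
  intro i
  have h0 := (Finset.sum_eq_zero_iff_of_nonneg hnn).1
    (le_antisymm hz' (Finset.sum_nonneg hnn)) i (Finset.mem_univ i)
  rw [integral_eq_zero_iff_of_nonneg (fun p => sq_nonneg _) (aux_sqdiff (hvstar i) (hvtil i))] at h0
  filter_upwards [h0] with p hp
  have : vstar i p.1 p.2 - vtil i p.1 p.2 = 0 := by simpa using hp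
  linarith
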